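/- Let G be a finite group with a normal subgroup N, let K ⊆ E be a field extension of finite degree s, and let A = M_m(E), regarded as a K-algebra. Suppose G acts on A on the right by K-algebra automorphisms, written x ↦ x^g, and suppose X : N → GL_m(E) is a group homomorphism such that: (i) x^n = X(n)⁻¹ x X(n) for all n ∈ N and x ∈ A; and (ii) X(n)^g = X(g⁻¹ n g) for all n ∈ N and g ∈ G. Let ι : A → M_{ms}(K) be a unitary embedding of K-algebras. Then there exists a function Y : G → GL_{ms}(K) satisfying: (1) Y(g)⁻¹ ι(x) Y(g) = ι(x^g) for all x ∈ A and g ∈ G; (2) Y(n) = ι(X(n)) for all n ∈ N; and (3) Y(gn) = Y(g)Y(n) and Y(ng) = Y(n)Y(g) for all n ∈ N and g ∈ G. -/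

import Mathlib

open Matrix in
/-- A simple-module identification: any `K`-algebra embedding of `M_m(E)` into `M_{ms}(K)` is
equivalent to the standard module `E^m`. -/
theorem exists_std_equiv {K E : Type} [Field K] [Field E] [Algebra K E] [FiniteDimensional K E]
    (s : ℕ) (hs : Module.finrank K E = s) (m : ℕ) (hm : 0 < m)
    (φ : Matrix (Fin m) (Fin m) E →ₐ[K] Matrix (Fin (m * s)) (Fin (m * s)) K)
    (hφ : Function.Injective φ) :
    ∃ T : (Fin m → E) ≃ₗ[K] (Fin (m * s) → K), ∀ x c, T (x *ᵥ c) = φ x *ᵥ T c := by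
  classical
  let z : Fin m := ⟨0, hm⟩
  let e : Fin m → E := Pi.single z 1
  have hee : e ⬝ᵥ e = 1 := by simp [e]
  have hne : vecMulVec e e ≠ 0 := by
    intro h
    have := congrFun (congrFun h z) z
    simp [vecMulVec_apply, e] at this
  have hne' : φ (vecMulVec e e) ≠ 0 := fun h => hne (hφ (by rw [h, map_zero]))
  obtain ⟨u, hu⟩ : ∃ u, φ (vecMulVec e e) *ᵥ u ≠ 0 := by
    by_contra! h
    apply hne'
    ext i j
    have := congrFun (h (Pi.single j 1)) i
    simpa using this
  let v := φ (vecMulVec e e) *ᵥ u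
  have hv : φ (vecMulVec e e) *ᵥ v = v := by
    simp only [v, mulVec_mulVec, ← map_mul]
    rw [vecMulVec_mul_vecMulVec, hee]
    simp
  have hv0 : v ≠ 0 := hu
  clear_value v
  let T : (Fin m → E) →ₗ[K] (Fin (m * s) → K) :=
    { toFun := fun c => φ (vecMulVec c e) *ᵥ v
      map_add' := fun a b => by rw [add_vecMulVec, map_add, add_mulVec]
      map_smul' := fun k a => by
        rw [smul_vecMulVec, map_smul, smul_mulVec]; rfl }
  have hT : ∀ c, T c = φ (vecMulVec c e) *ᵥ v := fun c => rfl
  have hlin : ∀ x c, T (x *ᵥ c) = φ x *ᵥ T c := by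
    intro x c
    rw [hT, hT, mulVec_mulVec, ← map_mul, mul_vecMulVec]
  have hinj : Function.Injective T := by
    rw [injective_iff_map_eq_zero]
    intro c hc
    by_contra hcne
    obtain ⟨i, hi⟩ := Function.ne_iff.mp hcne
    have h1 : T (vecMulVec e (Pi.single i (c i)⁻¹) *ᵥ c) = 0 := by
      rw [hlin, hc, mulVec_zero]
    have h2 : vecMulVec e (Pi.single i (c i)⁻¹) *ᵥ c = e := by
      have : c i ≠ 0 := hi
      rw [vecMulVec_mulVec]
      simp [this]
    rw [h2, hT, hv] at h1
    exact hv0 h1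
  have hdim : Module.finrank K (Fin m → E) = Module.finrank K (Fin (m * s) → K) := by
    rw [Module.finrank_pi_fintype]
    simp [hs]
  exact ⟨LinearEquiv.ofInjectiveOfFinrankEq T hinj hdim, fun x c => hlin x c⟩

open Matrix in
/-- Skolem–Noether for two embeddings of `M_m(E)` into `M_{ms}(K)`. -/
theorem exists_conj {K E : Type} [Field K] [Field E] [Algebra K E] [FiniteDimensional K E]
    (s : ℕ) (hs : Module.finrank K E = s) (m : ℕ) (hm : 0 < m)
    (φ ψ : Matrix (Fin m) (Fin m) E →ₐ[K] Matrix (Fin (m * s)) (Fin (m * s)) K)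
    (hφ : Function.Injective φ) (hψ : Function.Injective ψ) :
    ∃ Y : (Matrix (Fin (m * s)) (Fin (m * s)) K)ˣ, ∀ x, φ x * Y = Y * ψ x := by
  classical
  obtain ⟨T, hT⟩ := exists_std_equiv s hs m hm φ hφ
  obtain ⟨S, hS⟩ := exists_std_equiv s hs m hm ψ hψ
  let R := S.symm.trans T
  have hR : ∀ x w, R (ψ x *ᵥ w) = φ x *ᵥ R w := by
    intro x w
    obtain ⟨c, rfl⟩ := S.surjective w
    simp [R, ← hS, hT]
  refine ⟨⟨LinearMap.toMatrix' R.toLinearMap, LinearMap.toMatrix' R.symm.toLinearMap, ?_, ?_⟩, ?_⟩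
  · rw [← LinearMap.toMatrix'_comp]; simp
  · rw [← LinearMap.toMatrix'_comp]; simp
  · intro x
    apply Matrix.toLin'.injective
    refine LinearMap.ext fun w => ?_
    rw [Matrix.toLin'_mul, Matrix.toLin'_mul]
    simp only [LinearMap.comp_apply, Matrix.toLin'_toMatrix', Matrix.toLin'_apply]
    exact (hR x w).symm

/-- Let `G` be a finite group with normal subgroup `N`, `K ⊆ E` a field
extension of finite degree `s`, and `A = M_m(E)` a `K`-algebra. Suppose `G` acts on `A` on the
right by `K`-algebra automorphisms, `X : N → GL_m(E)` is a group homomorphism with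
`x^n = X(n)⁻¹ x X(n)` and `X(n)^g = X(g⁻¹ n g)`, and `ι : A → M_{ms}(K)` is a unitary embedding
of `K`-algebras. Then there is `Y : G → GL_{ms}(K)` with
(1) `Y(g)⁻¹ ι(x) Y(g) = ι(x^g)`, (2) `Y(n) = ι(X(n))` for `n ∈ N`, and
(3) `Y(gn) = Y(g)Y(n)` and `Y(ng) = Y(n)Y(g)`. -/
theorem stmt_3 (G : Type) [Group G] [Fintype G] (N : Subgroup G) (hN : N.Normal)
    (K E : Type) [Field K] [Field E] [Algebra K E] [FiniteDimensional K E]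
    (s : ℕ) (hs : Module.finrank K E = s) (m : ℕ) (hm : 0 < m)
    (act : G → (Matrix (Fin m) (Fin m) E ≃ₐ[K] Matrix (Fin m) (Fin m) E))
    (hact1 : ∀ x : Matrix (Fin m) (Fin m) E, act 1 x = x)
    (hactmul : ∀ (g h : G) (x : Matrix (Fin m) (Fin m) E), act h (act g x) = act (g * h) x)
    (X : N →* (Matrix (Fin m) (Fin m) E)ˣ)
    (hXconj : ∀ (n : N) (x : Matrix (Fin m) (Fin m) E),
      act ↑n x = (↑((X n)⁻¹) : Matrix (Fin m) (Fin m) E) * x * (↑(X n) : Matrix (Fin m) (Fin m) E))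
    (hXact : ∀ (n : N) (g : G),
      act g (↑(X n) : Matrix (Fin m) (Fin m) E)
        = (↑(X ⟨g⁻¹ * ↑n * g, hN.conj_mem' ↑n n.2 g⟩) : Matrix (Fin m) (Fin m) E))
    (ι : Matrix (Fin m) (Fin m) E →ₐ[K] Matrix (Fin (m * s)) (Fin (m * s)) K)
    (hι : Function.Injective ⇑ι) :
    ∃ Y : G → (Matrix (Fin (m * s)) (Fin (m * s)) K)ˣ,
      (∀ (x : Matrix (Fin m) (Fin m) E) (g : G),
        (↑((Y g)⁻¹) : Matrix (Fin (m * s)) (Fin (m * s)) K) * ι x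
            * (↑(Y g) : Matrix (Fin (m * s)) (Fin (m * s)) K)
          = ι (act g x)) ∧
      (∀ n : N, (↑(Y ↑n) : Matrix (Fin (m * s)) (Fin (m * s)) K)
          = ι (↑(X n) : Matrix (Fin m) (Fin m) E)) ∧
      (∀ (g : G) (n : N), Y (g * ↑n) = Y g * Y ↑n ∧ Y (↑n * g) = Y ↑n * Y g) := by
  classical
  let ιX : N →* (Matrix (Fin (m * s)) (Fin (m * s)) K)ˣ :=
    (Units.map (ι : Matrix (Fin m) (Fin m) E →* Matrix (Fin (m * s)) (Fin (m * s)) K)).comp X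
  have hιX : ∀ n, (ιX n : Matrix (Fin (m * s)) (Fin (m * s)) K) = ι (X n) := fun n => rfl
  have hN1 : ∀ (n : N) x, ι x * ιX n = ιX n * ι (act n x) := by
    intro n x
    rw [hιX, hXconj, ← map_mul, ← map_mul, ← mul_assoc, ← mul_assoc, Units.mul_inv, one_mul]
  have hY0 : ∀ g : G, ∃ Y : (Matrix (Fin (m * s)) (Fin (m * s)) K)ˣ,
      (∀ x, ι x * Y = Y * ι (act g x)) ∧ ∀ h : g ∈ N, Y = ιX ⟨g, h⟩ := by
    intro g
    by_cases hg : g ∈ N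
    · exact ⟨ιX ⟨g, hg⟩, hN1 ⟨g, hg⟩, fun _ => rfl⟩
    · obtain ⟨Y, hY⟩ := exists_conj s hs m hm ι
        (ι.comp (act g : Matrix (Fin m) (Fin m) E →ₐ[K] Matrix (Fin m) (Fin m) E)) hι
        (hι.comp (act g).injective)
      exact ⟨Y, hY, fun h => absurd h hg⟩
  choose Y0 hY01 hY02 using hY0
  let r : G → G := fun g => Quotient.out (g : G ⧸ N)
  have hr : ∀ g, (r g)⁻¹ * g ∈ N := fun g =>
    QuotientGroup.eq.mp (QuotientGroup.out_eq' (g : G ⧸ N))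
  have hrn : ∀ (g : G) (n : N), r (g * n) = r g := by
    intro g n
    simp [r]
  let Y : G → (Matrix (Fin (m * s)) (Fin (m * s)) K)ˣ :=
    fun g => Y0 (r g) * ιX ⟨(r g)⁻¹ * g, hr g⟩
  have hY1 : ∀ g x, ι x * Y g = Y g * ι (act g x) := by
    intro g x
    simp only [Y, Units.val_mul]
    rw [← mul_assoc, hY01, mul_assoc, hN1, hactmul, mul_assoc, mul_inv_cancel_left]
  have hY2 : ∀ n : N, Y n = ιX n := by
    intro n
    have hrN : r n ∈ N := by
      have := N.mul_mem n.2 (N.inv_mem (hr n))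
      simpa using this
    simp only [Y]
    rw [hY02 _ hrN, ← map_mul]
    congr 1
    ext
    simp
  have hY3 : ∀ (g : G) (n : N), Y (g * n) = Y g * Y n := by
    intro g n
    rw [hY2]
    simp only [Y]
    rw [mul_assoc, ← map_mul]
    have h1 : (⟨(r (g * n))⁻¹ * (g * n), hr _⟩ : N) = ⟨(r g)⁻¹ * g, hr g⟩ * n := by
      ext
      simp [hrn, mul_assoc]
    rw [h1, hrn]
  clear_value Y
  refine ⟨Y, ?_, fun n => by rw [hY2]; rfl, fun g n => ⟨hY3 g n, ?_⟩⟩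
  · intro x g
    rw [mul_assoc, hY1, Units.inv_mul_cancel_left]
  · have h := hY3 g ⟨g⁻¹ * ↑n * g, hN.conj_mem' ↑n n.2 g⟩
    have e : g * (g⁻¹ * ↑n * g) = ↑n * g := by group
    simp only [e] at h
    rw [h]
    ext1
    rw [Units.val_mul, hY2 n, hY2 ⟨g⁻¹ * ↑n * g, hN.conj_mem' ↑n n.2 g⟩,
      Units.val_mul, hιX, hιX, hY1, hXact]
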